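/- arXiv:1012.0548 — 3 statements merged into one kernel-verified Lean document; each statement's English description precedes it below -/
import Mathlib

section
/- Let A be a finite set of lines in the plane ℝ², let S₁ ⊆ ℝ² be an open halfplane, and let S₂ ⊆ ℝ² be an arbitrary set. Then μ_A(S₁ ∪ S₂) ≤ μ_A(S₁) · μ_A(S₂), where μ_A(S) denotes the maximum cardinality of an S-concentrated subset of A. -/
open RealInnerProductSpace

/-- A line in ℝ²: a 1-dimensional affine subspace, i.e. a set of the form
`{p + t • v : t ∈ ℝ}` with `v ≠ 0`. -/
def IsLine (L : Set (EuclideanSpace ℝ (Fin 2))) : Prop :=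
  ∃ p v : EuclideanSpace ℝ (Fin 2), v ≠ 0 ∧ L = {x | ∃ t : ℝ, x = p + t • v}

/-- An open halfplane in ℝ². -/
def IsOpenHalfplane (h : Set (EuclideanSpace ℝ (Fin 2))) : Prop :=
  ∃ (v : EuclideanSpace ℝ (Fin 2)) (c : ℝ), v ≠ 0 ∧ h = {x | c < ⟪v, x⟫}

/-- A set `A` of lines is `S`-concentrated if all pairwise intersection points of
distinct lines of `A` lie in `S`. -/
def Concentrated (A : Finset (Set (EuclideanSpace ℝ (Fin 2))))
    (S : Set (EuclideanSpace ℝ (Fin 2))) : Prop :=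
  ∀ l₁ ∈ A, ∀ l₂ ∈ A, l₁ ≠ l₂ → l₁ ∩ l₂ ⊆ S

/-- `μ_A(S)`: the maximum cardinality of an `S`-concentrated subset of `A`. -/
noncomputable def mu (A : Finset (Set (EuclideanSpace ℝ (Fin 2))))
    (S : Set (EuclideanSpace ℝ (Fin 2))) : ℕ :=
  sSup {m | ∃ A' ⊆ A, Concentrated A' S ∧ A'.card = m}

/-- Mirsky's bound: if every chain of a finite set has at most `n` elements and every antichain
at most `m`, then the set has at most `n * m` elements. -/
lemma card_le_mul_of_chain_antichain {α : Type*} (r : α → α → Prop)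
    (hirr : ∀ x, ¬ r x x) (htrans : ∀ x y z, r x y → r y z → r x z) (m n : ℕ) (B : Finset α)
    (hchain : ∀ C ⊆ B, (∀ x ∈ C, ∀ y ∈ C, x ≠ y → r x y ∨ r y x) → C.card ≤ n)
    (hanti : ∀ C ⊆ B, (∀ x ∈ C, ∀ y ∈ C, ¬ r x y) → C.card ≤ m) :
    B.card ≤ n * m := by
  classical
  have exists_min (C : Finset α) (hC : C.Nonempty) : ∃ x ∈ C, ∀ y ∈ C, ¬ r y x := by
    let : PartialOrder α :=
      { le := fun x y => x = y ∨ r x y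
        lt := r
        le_refl := fun x => Or.inl rfl
        le_trans := by grind
        lt_iff_le_not_ge := by grind
        le_antisymm := by grind }
    obtain ⟨x, hx⟩ := C.exists_minimal hC
    exact ⟨x, hx.prop, fun y hy hyx => hx.not_lt hy hyx⟩
  induction n generalizing B with
  | zero =>
    rcases B.eq_empty_or_nonempty with rfl | ⟨x, hx⟩
    · simp
    · simpa using hchain {x} (by simpa using hx) (by simp)
  | succ n ih =>
    set M := B.filter fun x => ∀ y ∈ B, ¬ r y x with hM
    have hMB : M ⊆ B := Finset.filter_subset _ _
    have hMcard : M.card ≤ m := hanti M hMB (by grind)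
    have hrest : (B \ M).card ≤ n * m := by
      refine ih (B \ M) (fun C hC hCchain => ?_)
        fun C hC => hanti C (hC.trans Finset.sdiff_subset)
      rcases C.eq_empty_or_nonempty with rfl | hne
      · simp
      obtain ⟨x, hx, hxmin⟩ := exists_min C hne
      obtain ⟨y, hyB, hyx⟩ : ∃ y ∈ B, r y x := by
        have := hC hx
        grind
      have hy : ∀ z ∈ C, r y z := by grind
      have hyC : y ∉ C := fun h => hirr y (hy y h)
      have := hchain (insert y C) (by grind) (by grind)
      rw [Finset.card_insert_of_notMem hyC] at this
      omega
    have := Finset.card_sdiff_add_card_eq_card hMB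
    rw [add_mul, one_mul]
    omega

/-- The data of a line relative to the boundary of a halfplane: a line transversal to the
boundary, given by its intercept and slope, or a line parallel to it, given by its signed
height. -/
inductive LineData
  | graph (a b : ℝ)
  | level (t : ℝ)

namespace LineData

instance : Inhabited LineData := ⟨level 0⟩

/-- The set described by `LineData` in terms of a height function `u` and an abscissa `s`. -/
def toSet {E : Type*} (u s : E → ℝ) : LineData → Set E
  | graph a b => {x | s x = a + b * u x}
  | level t => {x | u x = t}

/-- The strict order whose comparable pairs are exactly the pairs of lines meeting at
nonpositive height. -/
inductive Below : LineData → LineData → Prop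
  | graph {a b a' b' : ℝ} : a ≤ a' → b < b' → Below (graph a b) (graph a' b')
  | level {t a b : ℝ} : t ≤ 0 → Below (level t) (graph a b)

lemma Below.irrefl (x : LineData) : ¬ Below x x := by
  rintro (⟨_, h⟩ | _)
  exact lt_irrefl _ h

lemma Below.trans (x y z : LineData) : Below x y → Below y z → Below x z := by
  rintro (⟨h₁, h₂⟩ | h₁) (⟨h₃, h₄⟩ | _)
  · exact .graph (h₁.trans h₃) (h₂.trans h₄)
  · exact .level h₁

variable {E : Type*} {u s : E → ℝ}

lemma Below.nonpos {l l' : LineData} (h : Below l l') {x : E} (hx : x ∈ l.toSet u s)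
    (hx' : x ∈ l'.toSet u s) : u x ≤ 0 := by
  cases h with
  | graph h₁ h₂ =>
    simp only [toSet, Set.mem_ofPred_eq] at hx hx'
    by_contra! hpos
    nlinarith
  | level h =>
    simp only [toSet, Set.mem_ofPred_eq] at hx
    linarith

lemma pos_of_not_below {l l' : LineData} (h : ¬ Below l l') (h' : ¬ Below l' l)
    (hne : l.toSet u s ≠ l'.toSet u s) {x : E} (hx : x ∈ l.toSet u s)
    (hx' : x ∈ l'.toSet u s) : 0 < u x := by
  cases l with
  | graph a b =>
    cases l' with
    | graph a' b' =>
      simp only [toSet, Set.mem_ofPred_eq] at hx hx'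
      rcases lt_trichotomy b b' with hb | rfl | hb
      · have ha : a' < a := by
          by_contra! ha
          exact h (.graph ha hb)
        by_contra! hu
        nlinarith
      · obtain rfl : a = a' := by linarith
        exact absurd rfl hne
      · have ha : a < a' := by
          by_contra! ha
          exact h' (.graph ha hb)
        by_contra! hu
        nlinarith
    | level t =>
      simp only [toSet, Set.mem_ofPred_eq] at hx'
      by_contra! hu
      exact h' (.level (hx' ▸ hu))
  | level t =>
    simp only [toSet, Set.mem_ofPred_eq] at hx
    cases l' with
    | graph a b =>
      by_contra! hu
      exact h (.level (hx ▸ hu))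
    | level t' =>
      simp only [toSet, Set.mem_ofPred_eq] at hx'
      obtain rfl : t = t' := by linarith
      exact absurd rfl hne

end LineData

lemma IsLine.exists_lineData {L : Set (EuclideanSpace ℝ (Fin 2))} (hL : IsLine L)
    {v : EuclideanSpace ℝ (Fin 2)} (hv : v ≠ 0) (c : ℝ) :
    ∃ l : LineData, L = l.toSet (fun x => ⟪v, x⟫ - c) (fun x => v 0 * x 1 - v 1 * x 0) := by
  obtain ⟨p, d, hd, rfl⟩ := hL
  have inner_eq (x : EuclideanSpace ℝ (Fin 2)) : ⟪v, x⟫ = v 0 * x 0 + v 1 * x 1 := by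
    simp [PiLp.inner_apply, Fin.sum_univ_two, mul_comm]
  have normSq_pos (w : EuclideanSpace ℝ (Fin 2)) (hw : w ≠ 0) : 0 < w 0 ^ 2 + w 1 ^ 2 := by
    have := real_inner_self_pos.mpr hw
    rw [PiLp.inner_apply, Fin.sum_univ_two] at this
    simpa [sq] using this
  have ext_iff (x y : EuclideanSpace ℝ (Fin 2)) : x = y ↔ x 0 = y 0 ∧ x 1 = y 1 := by
    rw [PiLp.ext_iff, Fin.forall_fin_two]
  have hv' := normSq_pos v hv
  have hd' := normSq_pos d hd
  by_cases hvd : v 0 * d 0 + v 1 * d 1 = 0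
  · refine ⟨.level (⟪v, p⟫ - c), ?_⟩
    ext x
    simp only [LineData.toSet, Set.mem_ofPred_eq, ext_iff, PiLp.add_apply, PiLp.smul_apply,
      smul_eq_mul, inner_eq]
    constructor
    · rintro ⟨t, h₀, h₁⟩
      rw [h₀, h₁]
      linear_combination t * hvd
    · intro h
      have hpar : (x 0 - p 0) * d 1 = (x 1 - p 1) * d 0 := by
        have h₀ : v 0 * ((x 0 - p 0) * d 1 - (x 1 - p 1) * d 0) = 0 := by
          linear_combination d 1 * h - (x 1 - p 1) * hvd
        have h₁ : v 1 * ((x 0 - p 0) * d 1 - (x 1 - p 1) * d 0) = 0 := by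
          linear_combination -d 0 * h + (x 0 - p 0) * hvd
        have : (v 0 ^ 2 + v 1 ^ 2) * ((x 0 - p 0) * d 1 - (x 1 - p 1) * d 0) = 0 := by
          linear_combination v 0 * h₀ + v 1 * h₁
        rcases mul_eq_zero.mp this with h | h
        · exact absurd h hv'.ne'
        · linarith
      refine ⟨((x 0 - p 0) * d 0 + (x 1 - p 1) * d 1) / (d 0 ^ 2 + d 1 ^ 2), ?_, ?_⟩
      · field_simp
        linear_combination d 1 * hpar
      · field_simp
        linear_combination -d 0 * hpar
  · set k := v 0 * d 0 + v 1 * d 1 with hk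
    set b := (v 0 * d 1 - v 1 * d 0) / k with hb
    have hbk : b * k = v 0 * d 1 - v 1 * d 0 := by
      rw [hb]
      field_simp
    refine ⟨.graph (v 0 * p 1 - v 1 * p 0 - b * (⟪v, p⟫ - c)) b, ?_⟩
    ext x
    simp only [LineData.toSet, Set.mem_ofPred_eq, ext_iff, PiLp.add_apply, PiLp.smul_apply,
      smul_eq_mul, inner_eq]
    constructor
    · rintro ⟨t, h₀, h₁⟩
      rw [h₀, h₁]
      linear_combination -t * hbk + b * t * hk
    · intro h
      have hpar : (x 0 - p 0) * d 1 = (x 1 - p 1) * d 0 := by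
        have : (v 0 ^ 2 + v 1 ^ 2) * ((x 0 - p 0) * d 1 - (x 1 - p 1) * d 0) = 0 := by
          linear_combination -k * h - (v 0 * (x 0 - p 0) + v 1 * (x 1 - p 1)) * hbk +
            (v 0 * (x 1 - p 1) - v 1 * (x 0 - p 0)) * hk
        rcases mul_eq_zero.mp this with h | h
        · exact absurd h hv'.ne'
        · linarith
      refine ⟨((x 0 - p 0) * d 0 + (x 1 - p 1) * d 1) / (d 0 ^ 2 + d 1 ^ 2), ?_, ?_⟩
      · field_simp
        linear_combination d 1 * hpar
      · field_simp
        linear_combination -d 0 * hpar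

section mu

variable (A : Finset (Set (EuclideanSpace ℝ (Fin 2)))) (S : Set (EuclideanSpace ℝ (Fin 2)))

lemma bddAbove_card_concentrated :
    BddAbove {m | ∃ A' ⊆ A, Concentrated A' S ∧ A'.card = m} := by
  refine ⟨A.card, ?_⟩
  rintro m ⟨A', hA', -, rfl⟩
  exact Finset.card_le_card hA'

lemma exists_concentrated_card_eq_mu : ∃ A' ⊆ A, Concentrated A' S ∧ A'.card = mu A S :=
  Nat.sSup_mem (s := {m | ∃ A' ⊆ A, Concentrated A' S ∧ A'.card = m})
    ⟨0, ∅, by simp, by simp [Concentrated], rfl⟩ (bddAbove_card_concentrated A S)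

variable {A S} in
lemma Concentrated.card_le_mu {A' : Finset (Set (EuclideanSpace ℝ (Fin 2)))} (hA' : A' ⊆ A)
    (h : Concentrated A' S) : A'.card ≤ mu A S :=
  le_csSup (bddAbove_card_concentrated A S) ⟨A', hA', h, rfl⟩

end mu

/-- For a finite set `A` of lines in ℝ², an open halfplane `S₁`, and an arbitrary
set `S₂`, `μ_A(S₁ ∪ S₂) ≤ μ_A(S₁) · μ_A(S₂)`. -/
theorem mu_union_le_mul (A : Finset (Set (EuclideanSpace ℝ (Fin 2))))
    (hA : ∀ L ∈ A, IsLine L)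
    (S₁ S₂ : Set (EuclideanSpace ℝ (Fin 2))) (hS₁ : IsOpenHalfplane S₁) :
    mu A (S₁ ∪ S₂) ≤ mu A S₁ * mu A S₂ := by
  obtain ⟨v, c, hv, rfl⟩ := hS₁
  obtain ⟨B, hBA, hB, hcard⟩ := exists_concentrated_card_eq_mu A ({x | c < ⟪v, x⟫} ∪ S₂)
  rw [← hcard, mul_comm]
  choose! f hf using fun L hL => (hA L hL).exists_lineData hv c
  refine card_le_mul_of_chain_antichain (fun L L' => (f L).Below (f L'))
    (fun _ => LineData.Below.irrefl _) (fun _ _ _ => LineData.Below.trans _ _ _) _ _ B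
    (fun C hC hchain => Concentrated.card_le_mu (hC.trans hBA) ?_)
    (fun C hC hanti => Concentrated.card_le_mu (hC.trans hBA) ?_)
  · rintro L hL L' hL' hne x ⟨hx, hx'⟩
    refine (hB L (hC hL) L' (hC hL') hne ⟨hx, hx'⟩).resolve_left ?_
    rw [Set.mem_ofPred_eq, not_lt]
    rw [hf L (hBA (hC hL))] at hx
    rw [hf L' (hBA (hC hL'))] at hx'
    rcases hchain L hL L' hL' hne with h | h
    · have := h.nonpos hx hx'
      exact sub_nonpos.mp this
    · have := h.nonpos hx' hx
      exact sub_nonpos.mp this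
  · rintro L hL L' hL' hne x ⟨hx, hx'⟩
    rw [hf L (hBA (hC hL))] at hx hne
    rw [hf L' (hBA (hC hL'))] at hx' hne
    exact sub_pos.mp (LineData.pos_of_not_below (hanti L hL L' hL') (hanti L' hL' L hL) hne hx hx')
end

section
/- For every positive integer k there exist finite sets A₁ and A₂ of lines in the plane ℝ², each consisting of exactly k² pairwise distinct lines, such that for every line ℓ in ℝ² there exist an index i ∈ {1,2} and a closed halfplane h bounded by ℓ with the property that every h-concentrated subset A' ⊆ A_i satisfies |A'| ≤ k. (That is, the square-root bound in the ham-sandwich theorem for two line arrangements is tight.) -/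
open RealInnerProductSpace

/-- `h` is a closed halfplane bounded by the line `ℓ`. -/
def IsClosedHalfplaneOf (ℓ h : Set (EuclideanSpace ℝ (Fin 2))) : Prop :=
  ∃ (v : EuclideanSpace ℝ (Fin 2)) (c : ℝ), v ≠ 0 ∧
    h = {x | c ≤ ⟪v, x⟫} ∧ ℓ = {x | ⟪v, x⟫ = c}

/-- The line through `(s + i, 1)` and `(s + j, -1)`. -/
def joinLine (s i j : ℝ) : Set (EuclideanSpace ℝ (Fin 2)) :=
  {x | x 0 = s + (i + j) / 2 + (i - j) / 2 * x 1}

lemma top_mem_joinLine (s i j : ℝ) : !₂[s + i, 1] ∈ joinLine s i j := by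
  simp only [joinLine, Set.mem_ofPred_eq, Matrix.cons_val_zero, Matrix.cons_val_one]
  ring

lemma bottom_mem_joinLine (s i j : ℝ) : !₂[s + j, -1] ∈ joinLine s i j := by
  simp only [joinLine, Set.mem_ofPred_eq, Matrix.cons_val_zero, Matrix.cons_val_one]
  ring

lemma joinLine_injective {s i j i' j' : ℝ} (h : joinLine s i j = joinLine s i' j') :
    i = i' ∧ j = j' := by
  have h₁ : !₂[s + i, 1] ∈ joinLine s i' j' := h ▸ top_mem_joinLine s i j
  have h₂ : !₂[s + j, -1] ∈ joinLine s i' j' := h ▸ bottom_mem_joinLine s i j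
  simp only [joinLine, Set.mem_ofPred_eq, Matrix.cons_val_zero,
    Matrix.cons_val_one] at h₁ h₂
  constructor <;> linarith

lemma isLine_joinLine (s i j : ℝ) : IsLine (joinLine s i j) := by
  refine ⟨!₂[s + (i + j) / 2, 0], !₂[(i - j) / 2, 1], fun h => ?_, ?_⟩
  · simpa using congrArg (fun x : EuclideanSpace ℝ (Fin 2) => x 1) h
  · ext x
    simp only [joinLine, Set.mem_ofPred_eq]
    constructor
    · intro hx
      refine ⟨x 1, ?_⟩
      ext n
      fin_cases n
      · simp [hx, mul_comm]
      · simp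
    · rintro ⟨t, rfl⟩
      simp [mul_comm]

open Classical in
/-- The lines joining each of the `k` points `(s + i, 1)` to each of the `k` points
`(s + j, -1)`, where `0 ≤ i, j < k`. -/
noncomputable def joinLines (k : ℕ) (s : ℝ) : Finset (Set (EuclideanSpace ℝ (Fin 2))) :=
  Finset.univ.image fun p : Fin k × Fin k => joinLine s (p.1 : ℕ) (p.2 : ℕ)

lemma isLine_of_mem_joinLines {k : ℕ} {s : ℝ} {L : Set (EuclideanSpace ℝ (Fin 2))}
    (hL : L ∈ joinLines k s) : IsLine L := by
  obtain ⟨p, -, rfl⟩ := Finset.mem_image.1 hL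
  exact isLine_joinLine _ _ _

lemma card_joinLines (k : ℕ) (s : ℝ) : (joinLines k s).card = k ^ 2 := by
  rw [joinLines, Finset.card_image_of_injective, Finset.card_univ, Fintype.card_prod,
    Fintype.card_fin, sq]
  rintro ⟨i, j⟩ ⟨i', j'⟩ h
  obtain ⟨h₁, h₂⟩ := joinLine_injective h
  simp only [Prod.mk.injEq]
  exact ⟨Fin.ext (by exact_mod_cast h₁), Fin.ext (by exact_mod_cast h₂)⟩

/-- If `h` misses all the points `(s + i, 1)`, or all the points `(s + i, -1)`, then
an `h`-concentrated subset of `joinLines k s` contains at most one line through each of them. -/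
lemma card_le_of_concentrated {k : ℕ} {s y : ℝ} {h : Set (EuclideanSpace ℝ (Fin 2))}
    (hy : y = 1 ∨ y = -1) (hh : ∀ i : Fin k, !₂[s + (i : ℕ), y] ∉ h)
    {A : Finset (Set (EuclideanSpace ℝ (Fin 2)))} (hA : A ⊆ joinLines k s)
    (hc : Concentrated A h) : A.card ≤ k := by
  classical
  obtain ⟨T, -, hT⟩ := Finset.subset_image_iff.1 hA
  have hline : ∀ p ∈ T, joinLine s (p.1 : ℕ) (p.2 : ℕ) ∈ A := fun p hp =>
    hT ▸ Finset.mem_image_of_mem _ hp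
  have hle : A.card ≤ T.card := hT ▸ Finset.card_image_le
  refine hle.trans ?_
  have key : ∀ g : Fin k × Fin k → Fin k,
      (∀ p, !₂[s + (g p : ℕ), y] ∈ joinLine s (p.1 : ℕ) (p.2 : ℕ)) → T.card ≤ k := by
    intro g hg
    have hinj : Set.InjOn g T := by
      intro p hp q hq hpq
      by_contra hne
      refine hh (g p) (hc _ (hline p hp) _ (hline q hq) (fun heq => hne ?_)
        ⟨hg p, by rw [hpq]; exact hg q⟩)
      obtain ⟨h₁, h₂⟩ := joinLine_injective heq
      exact Prod.ext (Fin.ext (by exact_mod_cast h₁)) (Fin.ext (by exact_mod_cast h₂))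
    simpa using Finset.card_le_card_of_injOn g (fun _ _ => Finset.mem_univ _) hinj
  rcases hy with rfl | rfl
  · exact key Prod.fst fun p => top_mem_joinLine _ _ _
  · exact key Prod.snd fun p => bottom_mem_joinLine _ _ _

lemma inner_fin_two (v x : EuclideanSpace ℝ (Fin 2)) : ⟪v, x⟫ = v 0 * x 0 + v 1 * x 1 := by
  simp [PiLp.inner_apply, Fin.sum_univ_two, mul_comm]

/-- A line in the plane is the zero set of an affine equation. -/
lemma IsLine.exists_eq {ℓ : Set (EuclideanSpace ℝ (Fin 2))} (hℓ : IsLine ℓ) :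
    ∃ (v : EuclideanSpace ℝ (Fin 2)) (c : ℝ), v ≠ 0 ∧ ℓ = {x | ⟪v, x⟫ = c} := by
  obtain ⟨p, w, hw, rfl⟩ := hℓ
  have hpos : w 0 ^ 2 + w 1 ^ 2 ≠ 0 := by
    intro h
    apply hw
    ext n
    fin_cases n
    · simp; nlinarith [sq_nonneg (w 0), sq_nonneg (w 1)]
    · simp; nlinarith [sq_nonneg (w 0), sq_nonneg (w 1)]
  refine ⟨!₂[-w 1, w 0], -w 1 * p 0 + w 0 * p 1, fun h => hpos ?_, ?_⟩
  · have h₀ := congrArg (fun x : EuclideanSpace ℝ (Fin 2) => x 0) h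
    have h₁ := congrArg (fun x : EuclideanSpace ℝ (Fin 2) => x 1) h
    simp at h₀ h₁
    simp [h₀, h₁]
  · ext x
    simp only [Set.mem_ofPred_eq, inner_fin_two, Matrix.cons_val_zero,
      Matrix.cons_val_one]
    constructor
    · rintro ⟨t, rfl⟩
      simp only [PiLp.add_apply, PiLp.smul_apply, smul_eq_mul]
      ring
    · intro hx
      refine ⟨((x 0 - p 0) * w 0 + (x 1 - p 1) * w 1) / (w 0 ^ 2 + w 1 ^ 2), ?_⟩
      ext n
      fin_cases n
      · simp only [Fin.zero_eta, PiLp.add_apply, PiLp.smul_apply, smul_eq_mul]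
        field_simp
        linear_combination -w 1 * hx
      · simp only [Fin.mk_one, PiLp.add_apply, PiLp.smul_apply, smul_eq_mul]
        field_simp
        linear_combination w 0 * hx

/-- For a linear equation `a x + b y = c`, one of the two open sides contains a whole row of
points `(s + i, y)`, `0 ≤ i < k`, with `s ∈ {0, k}` and `y ∈ {1, -1}`. -/
lemma exists_row_on_one_side (k : ℕ) {a b : ℝ} (c : ℝ) (hab : a ≠ 0 ∨ b ≠ 0) :
    ∃ s : ℝ, (s = 0 ∨ s = k) ∧ ∃ y : ℝ, (y = 1 ∨ y = -1) ∧
      ((∀ i : Fin k, a * (s + (i : ℕ)) + b * y < c) ∨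
        (∀ i : Fin k, c < a * (s + (i : ℕ)) + b * y)) := by
  have hi : ∀ i : Fin k, (0 : ℝ) ≤ (i : ℕ) ∧ ((i : ℕ) : ℝ) + 1 ≤ k := fun i =>
    ⟨Nat.cast_nonneg _, by exact_mod_cast i.2⟩
  obtain ⟨y, hy, hby⟩ : ∃ y : ℝ, (y = 1 ∨ y = -1) ∧ b * y = |b| := by
    rcases le_total 0 b with h | h
    · exact ⟨1, Or.inl rfl, by simp [abs_of_nonneg h]⟩
    · exact ⟨-1, Or.inr rfl, by simp [abs_of_nonpos h]⟩
  have hy' : -y = 1 ∨ -y = -1 := by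
    rcases hy with rfl | rfl <;> simp
  have hb := abs_nonneg b
  rcases lt_trichotomy a 0 with ha | rfl | ha
  · rcases le_total c (a * (k - 1 / 2)) with hc | hc
    · refine ⟨0, Or.inl rfl, y, hy, Or.inr fun i => ?_⟩
      nlinarith [hi i]
    · refine ⟨k, Or.inr rfl, -y, hy', Or.inl fun i => ?_⟩
      nlinarith [hi i]
  · have hb' : 0 < |b| := abs_pos.2 (hab.resolve_left (by simp))
    rcases le_total c 0 with hc | hc
    · exact ⟨0, Or.inl rfl, y, hy, Or.inr fun i => by linarith⟩
    · exact ⟨0, Or.inl rfl, -y, hy', Or.inl fun i => by linarith⟩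
  · rcases le_total c (a * (k - 1 / 2)) with hc | hc
    · refine ⟨k, Or.inr rfl, y, hy, Or.inr fun i => ?_⟩
      nlinarith [hi i]
    · refine ⟨0, Or.inl rfl, -y, hy', Or.inl fun i => ?_⟩
      nlinarith [hi i]

/-- Every line bounds a closed halfplane that misses a row of points as in
`exists_row_on_one_side`. -/
lemma IsLine.exists_halfplane_avoiding_row (k : ℕ) {ℓ : Set (EuclideanSpace ℝ (Fin 2))}
    (hℓ : IsLine ℓ) :
    ∃ h, IsClosedHalfplaneOf ℓ h ∧ ∃ s : ℝ, (s = 0 ∨ s = k) ∧ ∃ y : ℝ, (y = 1 ∨ y = -1) ∧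
      ∀ i : Fin k, !₂[s + (i : ℕ), y] ∉ h := by
  obtain ⟨v, c, hv, rfl⟩ := hℓ.exists_eq
  have hab : v 0 ≠ 0 ∨ v 1 ≠ 0 := by
    by_contra! h
    apply hv
    ext n
    fin_cases n
    · exact h.1
    · exact h.2
  obtain ⟨s, hs, y, hy, hrow | hrow⟩ := exists_row_on_one_side k c hab
  · refine ⟨_, ⟨v, c, hv, rfl, rfl⟩, s, hs, y, hy, fun i => ?_⟩
    simpa [inner_fin_two] using hrow i
  · refine ⟨_, ⟨-v, -c, neg_ne_zero.2 hv, rfl, ?_⟩, s, hs, y, hy, fun i => ?_⟩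
    · simp only [inner_neg_left, neg_inj]
    · have := hrow i
      simp only [inner_neg_left, Set.mem_ofPred_eq, inner_fin_two,
        Matrix.cons_val_zero, Matrix.cons_val_one]
      linarith

/-- Tightness of the square-root bound in the ham-sandwich theorem for two line
arrangements: there are two sets of `k²` lines each such that for every line `ℓ`
there are an index `i ∈ {1,2}` and a closed halfplane `h` bounded by `ℓ` in which
every `h`-concentrated subset of `A_i` has at most `k` lines. -/
theorem ham_sandwich_lines_tight (k : ℕ) (hk : 1 ≤ k) :
    ∃ A₁ A₂ : Finset (Set (EuclideanSpace ℝ (Fin 2))),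
      (∀ L ∈ A₁, IsLine L) ∧ (∀ L ∈ A₂, IsLine L) ∧
      A₁.card = k ^ 2 ∧ A₂.card = k ^ 2 ∧
      ∀ ℓ : Set (EuclideanSpace ℝ (Fin 2)), IsLine ℓ →
        ∃ h : Set (EuclideanSpace ℝ (Fin 2)), IsClosedHalfplaneOf ℓ h ∧
          ((∀ A' ⊆ A₁, Concentrated A' h → A'.card ≤ k) ∨
           (∀ A' ⊆ A₂, Concentrated A' h → A'.card ≤ k)) := by
  refine ⟨joinLines k 0, joinLines k k, fun _ => isLine_of_mem_joinLines,
    fun _ => isLine_of_mem_joinLines, card_joinLines k 0, card_joinLines k k, fun ℓ hℓ => ?_⟩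
  obtain ⟨h, hh, s, rfl | rfl, y, hy, hrow⟩ := hℓ.exists_halfplane_avoiding_row k
  · exact ⟨h, hh, Or.inl fun _ => card_le_of_concentrated hy hrow⟩
  · exact ⟨h, hh, Or.inr fun _ => card_le_of_concentrated hy hrow⟩
end

section
/- Let n ≥ 2 and let ℓ₁, …, ℓ_n be pairwise distinct lines in ℝ², where ℓ_i = {(x,y) ∈ ℝ² : y = a_i (x − b_i)} with a_i ≠ 0 for each i and with b₁, …, b_n pairwise distinct. Suppose that for all i ≠ j, every point of ℓ_i ∩ ℓ_j has negative y-coordinate. Then for every real s with 0 < s ≤ min_i |a_i|, there exists ŷ > 0 such that for all i ≠ j and all points (x₁, y₁) ∈ ℓ_i and (x₂, y₂) ∈ ℓ_j with y₁, y₂ ∈ [0, ŷ], one has |y₁ − y₂| ≤ s · |x₁ − x₂| (i.e., the segment joining them has slope in [−s, s]). -/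
/-- A finite injective family of reals is uniformly separated. -/
theorem Function.Injective.exists_pos_le_abs_sub {ι : Type*} [Finite ι] {b : ι → ℝ}
    (hb : Function.Injective b) :
    ∃ δ : ℝ, 0 < δ ∧ ∀ i j, i ≠ j → δ ≤ |b i - b j| := by
  have h : ∀ᶠ δ : ℝ in nhdsWithin 0 (Set.Ioi 0), ∀ i j, i ≠ j → δ ≤ |b i - b j| := by
    refine Filter.eventually_all.2 fun i => Filter.eventually_all.2 fun j => ?_
    by_cases hij : i = j
    · simp [hij]
    · have hpos : 0 < |b i - b j| := abs_pos.2 (sub_ne_zero.2 (hb.ne hij))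
      filter_upwards [Ioo_mem_nhdsGT hpos] with δ hδ _ using hδ.2.le
  obtain ⟨δ, hδ, hpos⟩ := (h.and self_mem_nhdsWithin).exists
  exact ⟨δ, hpos, hδ⟩

/-- A point of height in `[0, y]` on a line of slope at least `s` in absolute value is
horizontally within `y / s` of the crossing with the `x`-axis. -/
theorem mul_abs_sub_le_of_mem_line {a b s y : ℝ} (hsa : s ≤ |a|) {p : ℝ × ℝ}
    (hp : p.2 = a * (p.1 - b)) (hy : p.2 ∈ Set.Icc (0 : ℝ) y) : s * |p.1 - b| ≤ y :=
  calc s * |p.1 - b| ≤ |a| * |p.1 - b| := by gcongr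
    _ = p.2 := by rw [← abs_mul, ← hp, abs_of_nonneg hy.1]
    _ ≤ y := hy.2


/-- Lines `ℓ_i = {(x, y) : y = a_i (x − b_i)}` in ℝ² with nonzero slopes `a_i`,
pairwise distinct `x`-axis crossings `b_i`, and all pairwise intersection points
below the `x`-axis: then for every `0 < s ≤ min_i |a_i|` there is `ŷ > 0` such
that every segment joining points of two distinct lines whose `y`-coordinates lie
in `[0, ŷ]` has slope in `[−s, s]`. -/
theorem flat_segments_near_x_axis (n : ℕ) (hn : 2 ≤ n) (a b : Fin n → ℝ)
    (ha : ∀ i, a i ≠ 0) (hb : Function.Injective b)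
    (ℓ : Fin n → Set (ℝ × ℝ))
    (hℓ : ∀ i, ℓ i = {p : ℝ × ℝ | p.2 = a i * (p.1 - b i)})
    (hdist : Function.Injective ℓ)
    (hneg : ∀ i j : Fin n, i ≠ j → ∀ p ∈ ℓ i ∩ ℓ j, p.2 < 0)
    (s : ℝ) (hs : 0 < s) (hsa : ∀ i, s ≤ |a i|) :
    ∃ yhat : ℝ, 0 < yhat ∧
      ∀ i j : Fin n, i ≠ j → ∀ p ∈ ℓ i, ∀ q ∈ ℓ j,
        p.2 ∈ Set.Icc (0 : ℝ) yhat → q.2 ∈ Set.Icc (0 : ℝ) yhat →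
        |p.2 - q.2| ≤ s * |p.1 - q.1| := by
  obtain ⟨δ, hδ, hsep⟩ := hb.exists_pos_le_abs_sub
  refine ⟨s * δ / 3, by positivity, fun i j hij p hp q hq hpy hqy => ?_⟩
  rw [hℓ] at hp hq
  have hpb := mul_abs_sub_le_of_mem_line (hsa i) hp hpy
  have hqb := mul_abs_sub_le_of_mem_line (hsa j) hq hqy
  have hy : |p.2 - q.2| ≤ s * δ / 3 :=
    abs_sub_le_iff.2 ⟨by linarith [hpy.2, hqy.1], by linarith [hqy.2, hpy.1]⟩
  have htri : δ ≤ |p.1 - b i| + |p.1 - q.1| + |q.1 - b j| := by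
    have h₁ := abs_sub_le (b i) p.1 (b j)
    have h₂ := abs_sub_le p.1 q.1 (b j)
    rw [abs_sub_comm (b i) p.1] at h₁
    linarith [hsep i j hij]
  have hmul := mul_le_mul_of_nonneg_left htri hs.le
  linarith
end
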